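/- Let H be an elementary abelian 2-hypergroup built from involutions q_1,…,q_p, let G ⊆ H, and let r be the unique element of H whose support consists precisely of all thick elements of H among q_1,…,q_p. Then G is a strongly normal closed subset of H if and only if O^ϑ(G) = O^ϑ(H) = ⟨r⟩ and there exists F ⊆ H such that F^γ is a subgroup of the elementary abelian 2-group O_ϑ(H)^γ, G = ⟨r⟩·F, ⟨r⟩ ∩ F = {e}, and O_ϑ(G) = F. -/

import Mathlib

namespace HyperPaper

/-- A hypergroup: hypermultiplication `hmul`, inversion `star`, identity `e`,
satisfying (H1) associativity, (H2) unique two-sided identity, (H3) exchange conditions. -/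
structure Hypergroup (H : Type*) where
  hmul : H → H → Set H
  star : H → H
  e : H
  idl : ∀ p, hmul e p = {p}
  idr : ∀ p, hmul p e = {p}
  e_unique : ∀ e' : H, (∀ p, hmul e' p = {p} ∧ hmul p e' = {p}) → e' = e
  assoc : ∀ p q r : H, (⋃ x ∈ hmul p q, hmul x r) = ⋃ x ∈ hmul q r, hmul p x
  h3l : ∀ p q r : H, p ∈ hmul q r ↔ q ∈ hmul p (star r)
  h3r : ∀ p q r : H, p ∈ hmul q r ↔ r ∈ hmul (star q) p

variable {H : Type*}

namespace Hypergroup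

/-- Product of two subsets: FG = {a : ∃ b ∈ F, c ∈ G, a ∈ bc}. -/
def smul (hg : Hypergroup H) (F G : Set H) : Set H :=
  {a | ∃ b ∈ F, ∃ c ∈ G, a ∈ hg.hmul b c}

/-- Closed subset: nonempty and G*G ⊆ G. -/
def IsClosed (hg : Hypergroup H) (G : Set H) : Prop :=
  G.Nonempty ∧ hg.smul (hg.star '' G) G ⊆ G

/-- Thin element: p*p = {e}. -/
def IsThin (hg : Hypergroup H) (p : H) : Prop := hg.hmul (hg.star p) p = {hg.e}

/-- Thick element: not thin. -/
def IsThick (hg : Hypergroup H) (p : H) : Prop := ¬ hg.IsThin p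

/-- Involution: p ≠ e and {e, p} is closed. -/
def IsInvolution (hg : Hypergroup H) (p : H) : Prop :=
  p ≠ hg.e ∧ hg.IsClosed {hg.e, p}

/-- ⟨G⟩: smallest closed subset containing G. -/
def gen (hg : Hypergroup H) (G : Set H) : Set H := ⋂₀ {C | hg.IsClosed C ∧ G ⊆ C}

/-- O_ϑ(G): the thin elements of H lying in G. -/
def Othin (hg : Hypergroup H) (G : Set H) : Set H := {p ∈ G | hg.IsThin p}

/-- F is a strongly normal closed subset of G: p*Fp ⊆ F ⊆ G for all p ∈ G. -/
def IsStronglyNormal (hg : Hypergroup H) (F G : Set H) : Prop :=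
  hg.IsClosed F ∧ hg.IsClosed G ∧ F ⊆ G ∧
    ∀ p ∈ G, hg.smul (hg.smul {hg.star p} F) {p} ⊆ F

/-- O^ϑ(G): intersection of all strongly normal closed subsets of ⟨G⟩. -/
def Osup (hg : Hypergroup H) (G : Set H) : Set H :=
  ⋂₀ {F | hg.IsStronglyNormal F (hg.gen G)}

/-- F is a normal closed subset of G. -/
def IsNormal (hg : Hypergroup H) (F G : Set H) : Prop :=
  hg.IsClosed F ∧ hg.IsClosed G ∧ F ⊆ G ∧ ∀ p ∈ G, hg.smul F {p} = hg.smul {p} F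

/-- Product of a list of subsets (empty product is {e}). -/
def listProd (hg : Hypergroup H) : List (Set H) → Set H
  | [] => {hg.e}
  | a :: l => hg.smul a (hg.listProd l)

/-- Product r_1 r_2 ⋯ r_n of a family of elements. -/
def famProd (hg : Hypergroup H) {n : ℕ} (r : Fin n → H) : Set H :=
  hg.listProd ((List.finRange n).map fun i => ({r i} : Set H))

/-- Ĝ_i: the product of the G_j with j ≠ i. -/
def cofactor (hg : Hypergroup H) {n : ℕ} (G : Fin n → Set H) (i : Fin n) : Set H :=
  hg.listProd (((List.finRange n).filter fun j => decide (j ≠ i)).map G)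

/-- H is the direct product of the normal closed subsets G_1, …, G_n. -/
def IsDirectProduct (hg : Hypergroup H) {n : ℕ} (G : Fin n → Set H) : Prop :=
  (∀ i, hg.IsNormal (G i) Set.univ) ∧
  (∀ i, hg.smul (G i) (hg.cofactor G i) = Set.univ) ∧
  (∀ i, G i ∩ hg.cofactor G i = {hg.e})

/-- r : Fin n → H is a decomposition of x with respect to the family G. -/
def IsDecomp (hg : Hypergroup H) {n : ℕ} (G : Fin n → Set H) (x : H) (r : Fin n → H) : Prop :=
  (∀ i, r i ∈ G i) ∧ x ∈ hg.famProd r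

/-- The support of x: the elements ≠ e appearing in the decomposition of x. -/
def dsupport (hg : Hypergroup H) {n : ℕ} (G : Fin n → Set H) (x : H) : Set H :=
  {y | y ≠ hg.e ∧ ∃ r, hg.IsDecomp G x r ∧ y ∈ Set.range r}

/-- The cover of x: the product r_1r_2⋯r_n for the decomposition of x. -/
def dcover (hg : Hypergroup H) {n : ℕ} (G : Fin n → Set H) (x : H) : Set H :=
  {y | ∃ r, hg.IsDecomp G x r ∧ y ∈ hg.famProd r}

/-- x is constrained: its cover equals {x}. -/
def IsConstrained (hg : Hypergroup H) {n : ℕ} (G : Fin n → Set H) (x : H) : Prop :=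
  hg.dcover G x = {x}

/-- r_2(G): the largest 2-rank of a thin closed subset of H contained in G
(equivalently, the largest k such that G contains a thin symmetric closed subset
of 2^k elements, which corresponds to an elementary abelian 2-group of 2-rank k). -/
noncomputable def rank2 (hg : Hypergroup H) (G : Set H) : ℕ :=
  sSup {k | ∃ U : Set H, hg.IsClosed U ∧ U ⊆ G ∧ (∀ u ∈ U, hg.IsThin u) ∧
    (∀ u ∈ U, hg.star u = u) ∧ U.ncard = 2 ^ k}

/-- F is a minimal generating subset of G. -/
def IsMinGen (hg : Hypergroup H) (G F : Set H) : Prop :=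
  F ⊆ G ∧ hg.gen F = G ∧ ∀ p ∈ F, hg.gen (F \ {p}) ≠ G

/-- The dimension of G: the smallest cardinality of a minimal generating subset. -/
noncomputable def dimension (hg : Hypergroup H) (G : Set H) : ℕ :=
  sInf {k | ∃ F : Set H, hg.IsMinGen G F ∧ F.Finite ∧ F.ncard = k}

/-- [F, G] = ⟨{a : ∃ b ∈ F, c ∈ G, a ∈ b*c*bc}⟩. -/
def commSet (hg : Hypergroup H) (F G : Set H) : Set H :=
  hg.gen {a | ∃ b ∈ F, ∃ c ∈ G,
    a ∈ hg.smul (hg.smul (hg.smul {hg.star b} {hg.star c}) {b}) {c}}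

/-- derived G k = G^{(k+1)}: G^{(1)} = G, G^{(r)} = [G^{(r-1)}, G]. -/
def derived (hg : Hypergroup H) (G : Set H) : ℕ → Set H
  | 0 => G
  | k + 1 => hg.commSet (hg.derived G k) G

/-- G is nilpotent: G^{(r)} = {e} for some r. -/
def IsNilpotent (hg : Hypergroup H) (G : Set H) : Prop :=
  ∃ k : ℕ, hg.derived G k = {hg.e}

/-- G is a residually thin closed subset: there is a chain {e} = F_1, …, F_n = G of
pairwise distinct closed subsets, each strongly normal in the next. -/
def IsResiduallyThin (hg : Hypergroup H) (G : Set H) : Prop :=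
  ∃ (m : ℕ) (F : Fin (m + 1) → Set H), Function.Injective F ∧
    F 0 = {hg.e} ∧ F (Fin.last m) = G ∧
    ∀ i : Fin m, hg.IsStronglyNormal (F i.castSucc) (F i.succ)

/-- x^k as a subset: x^0 = {e}, x^{k+1} = x^k · x. -/
def spow (hg : Hypergroup H) (x : H) : ℕ → Set H
  | 0 => {hg.e}
  | k + 1 => hg.smul (hg.spow x k) {x}

/-- F is a maximal closed subset of G. -/
def IsMaximalClosed (hg : Hypergroup H) (F G : Set H) : Prop :=
  hg.IsClosed F ∧ hg.IsClosed G ∧ F ⊆ G ∧ F ≠ G ∧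
    ∀ E : Set H, hg.IsClosed E → F ⊆ E → E ⊆ G → E = F ∨ E = G

/-- The Frattini closed subset of G: the intersection (inside G) of all maximal
closed subsets of G. -/
def frattini (hg : Hypergroup H) (G : Set H) : Set H :=
  G ∩ ⋂₀ {F | hg.IsMaximalClosed F G}

/-- α is an isomorphism from the closed subset F to the closed subset G. -/
def IsIso (hg : Hypergroup H) (F G : Set H) (α : H → H) : Prop :=
  Set.BijOn α F G ∧ α hg.e = hg.e ∧
    ∀ p ∈ F, ∀ q ∈ F, α '' hg.hmul p q = hg.hmul (α p) (α q)

/-- F ≃ G: there is an isomorphism from F to G. -/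
def Isomorphic (hg : Hypergroup H) (F G : Set H) : Prop := ∃ α : H → H, hg.IsIso F G α

/-- Aut(G): the automorphism group of G, realized as the subgroup of permutations of G
that fix e and preserve the hypermultiplication. -/
def autGroup (hg : Hypergroup H) (G : Set H) : Subgroup (Equiv.Perm G) where
  carrier := {σ | (∀ x : G, (x : H) = hg.e → ((σ x : H)) = hg.e) ∧
    ∀ p q x : G, (x : H) ∈ hg.hmul p q ↔ ((σ x : H)) ∈ hg.hmul (σ p) (σ q)}
  one_mem' := by
    constructor
    · intro x hx; simpa using hx
    · intro p q x; simp
  mul_mem' := by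
    rintro σ τ ⟨he1, hm1⟩ ⟨he2, hm2⟩
    refine ⟨fun x hx => ?_, fun p q x => ?_⟩
    · simpa using he1 _ (he2 x hx)
    · simpa using (hm2 p q x).trans (hm1 (τ p) (τ q) (τ x))
  inv_mem' := by
    rintro σ ⟨he, hm⟩
    refine ⟨fun x hx => ?_, fun p q x => ?_⟩
    · have h2 : σ x = x := Subtype.ext ((he x hx).trans hx.symm)
      have h3 : σ⁻¹ x = x := by
        conv_lhs => rw [← h2]
        simp
      rw [h3]; exact hx
    · have h := hm (σ⁻¹ p) (σ⁻¹ q) (σ⁻¹ x)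
      simpa using h.symm

end Hypergroup

/-- An elementary abelian 2-hypergroup: a hypergroup that is the constrained direct
product of the closed subsets ⟨q_1⟩, …, ⟨q_n⟩ generated by involutions q_1, …, q_n. -/
structure EA2Data (H : Type*) where
  hg : Hypergroup H
  n : ℕ
  q : Fin n → H
  invol : ∀ i, hg.IsInvolution (q i)
  dp : hg.IsDirectProduct fun i => hg.gen {q i}
  constrained : ∀ x : H, hg.IsConstrained (fun i => hg.gen {q i}) x

namespace EA2Data

/-- The family ⟨q_1⟩, …, ⟨q_n⟩. -/
def fam (E : EA2Data H) : Fin E.n → Set H := fun i => E.hg.gen {E.q i}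

/-- The support of x. -/
def support (E : EA2Data H) (x : H) : Set H := E.hg.dsupport E.fam x

/-- Thick(F): externally thick elements of H lying in F. -/
def ThickIn (E : EA2Data H) (F : Set H) : Set H :=
  {x ∈ F | x = E.hg.e ∨ ∀ y ∈ E.support x, E.hg.IsThick y}

/-- Thin(F): externally thin elements of H lying in F. -/
def ThinIn (E : EA2Data H) (F : Set H) : Set H :=
  {x ∈ F | x = E.hg.e ∨ ∀ y ∈ E.support x, E.hg.IsThin y}

/-- The (unique) pair (x⁺, x⁻) with x⁺ ∈ Thick(H), x⁻ ∈ Thin(H), x⁺x⁻ = {x}. -/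
noncomputable def pm (E : EA2Data H) (x : H) : H × H :=
  @Classical.epsilon (H × H) ⟨(E.hg.e, E.hg.e)⟩ fun z =>
    z.1 ∈ E.ThickIn Set.univ ∧ z.2 ∈ E.ThinIn Set.univ ∧ E.hg.hmul z.1 z.2 = {x}

/-- x⁺. -/
noncomputable def plus (E : EA2Data H) (x : H) : H := (E.pm x).1

/-- x⁻. -/
noncomputable def minus (E : EA2Data H) (x : H) : H := (E.pm x).2

/-- s(x): the number of thick elements of H in the support of x. -/
noncomputable def sElem (E : EA2Data H) (x : H) : ℕ :=
  {y ∈ E.support x | E.hg.IsThick y}.ncard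

/-- s(G) = max {s(a) : a ∈ G}. -/
noncomputable def sSet (E : EA2Data H) (G : Set H) : ℕ :=
  sSup {k | ∃ a ∈ G, E.sElem a = k}

/-- x ⪯ y: the support of x is contained in the support of y. -/
def ple (E : EA2Data H) (x y : H) : Prop := E.support x ⊆ E.support y

/-- p♯: the number of thick elements among q_1, …, q_n. -/
noncomputable def psharp (E : EA2Data H) : ℕ := {i : Fin E.n | E.hg.IsThick (E.q i)}.ncard

end EA2Data

/-- The Gaussian binomial coefficient C(n, k)_2 with base 2, via the
q-Pascal recurrence C(n, k)_2 = C(n-1, k-1)_2 + 2^k · C(n-1, k)_2. -/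
def gaussBinom2 : ℕ → ℕ → ℕ
  | _, 0 => 1
  | 0, _ + 1 => 0
  | n + 1, k + 1 => gaussBinom2 n k + 2 ^ (k + 1) * gaussBinom2 n (k + 1)

end HyperPaper

open HyperPaper

namespace HyperPaper

namespace Hypergroup

variable {H : Type*} (hg : Hypergroup H)

theorem e_mem_star_mul (p : H) : hg.e ∈ hg.hmul (hg.star p) p :=
  (hg.h3r p p hg.e).1 (by simp [hg.idr])

theorem star_eq_of_e_mem {p q : H} (h : hg.e ∈ hg.hmul q p) : hg.star q = p := by
  have := (hg.h3r _ _ _).1 h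
  rw [hg.idr] at this
  exact this.symm

theorem star_star (p : H) : hg.star (hg.star p) = p :=
  hg.star_eq_of_e_mem (hg.e_mem_star_mul p)

theorem star_e : hg.star hg.e = hg.e :=
  hg.star_eq_of_e_mem (by simp [hg.idr])

theorem smul_singleton (p q : H) : hg.smul {p} {q} = hg.hmul p q := by
  ext; simp [smul]

theorem smul_assoc (A B C : Set H) :
    hg.smul (hg.smul A B) C = hg.smul A (hg.smul B C) := by
  ext x
  constructor
  · rintro ⟨y, ⟨a, ha, b, hb, hy⟩, c, hc, hx⟩
    have h : x ∈ ⋃ y ∈ hg.hmul a b, hg.hmul y c := Set.mem_biUnion hy hx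
    rw [hg.assoc] at h
    obtain ⟨z, hz, hx⟩ := Set.mem_iUnion₂.1 h
    exact ⟨a, ha, z, ⟨b, hb, c, hc, hz⟩, hx⟩
  · rintro ⟨a, ha, y, ⟨b, hb, c, hc, hy⟩, hx⟩
    have h : x ∈ ⋃ y ∈ hg.hmul b c, hg.hmul a y := Set.mem_biUnion hy hx
    rw [← hg.assoc] at h
    obtain ⟨z, hz, hx⟩ := Set.mem_iUnion₂.1 h
    exact ⟨z, ⟨a, ha, b, hb, hz⟩, c, hc, hx⟩

theorem smul_e (A : Set H) : hg.smul A {hg.e} = A := by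
  ext; simp [smul, hg.idr]

theorem e_smul (A : Set H) : hg.smul {hg.e} A = A := by
  ext; simp [smul, hg.idl]

theorem smul_mono {A B C D : Set H} (h : A ⊆ C) (h' : B ⊆ D) : hg.smul A B ⊆ hg.smul C D := by
  rintro x ⟨a, ha, b, hb, hx⟩
  exact ⟨a, h ha, b, h' hb, hx⟩

theorem subset_smul_left {A B : Set H} (h : hg.e ∈ B) : A ⊆ hg.smul A B := fun a ha =>
  ⟨a, ha, hg.e, h, by simp [hg.idr]⟩

theorem subset_smul_right {A B : Set H} (h : hg.e ∈ A) : B ⊆ hg.smul A B := fun b hb =>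
  ⟨hg.e, h, b, hb, by simp [hg.idl]⟩

section Closed

variable {hg}
variable {C : Set H}

theorem IsClosed.star_hmul_subset (h : hg.IsClosed C) {p q : H} (hp : p ∈ C) (hq : q ∈ C) :
    hg.hmul (hg.star p) q ⊆ C := fun _ hx =>
  h.2 ⟨hg.star p, ⟨p, hp, rfl⟩, q, hq, hx⟩

theorem IsClosed.e_mem (h : hg.IsClosed C) : hg.e ∈ C := by
  obtain ⟨p, hp⟩ := h.1
  exact h.star_hmul_subset hp hp (hg.e_mem_star_mul p)

theorem IsClosed.star_mem (h : hg.IsClosed C) {p : H} (hp : p ∈ C) : hg.star p ∈ C :=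
  h.star_hmul_subset hp h.e_mem (by simp [hg.idr])

theorem IsClosed.smul_subset (h : hg.IsClosed C) {A B : Set H} (hA : A ⊆ C) (hB : B ⊆ C) :
    hg.smul A B ⊆ C := by
  rintro x ⟨a, ha, b, hb, hx⟩
  rw [← hg.star_star a] at hx
  exact h.star_hmul_subset (h.star_mem (hA ha)) (hB hb) hx

theorem IsClosed.listProd_subset (h : hg.IsClosed C) {l : List (Set H)} (hl : ∀ A ∈ l, A ⊆ C) :
    hg.listProd l ⊆ C := by
  induction l with
  | nil => simpa [listProd] using h.e_mem
  | cons A l ih =>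
    exact h.smul_subset (hl A (by simp)) (ih fun B hB => hl B (by simp [hB]))

end Closed

theorem isClosed_gen (A : Set H) : hg.IsClosed (hg.gen A) := by
  refine ⟨⟨hg.e, fun C hC => hC.1.e_mem⟩, ?_⟩
  rintro x ⟨_, ⟨p, hp, rfl⟩, q, hq, hx⟩ C hC
  exact hC.1.star_hmul_subset (hp C hC) (hq C hC) hx

theorem subset_gen (A : Set H) : A ⊆ hg.gen A := fun _ hx _ hC => hC.2 hx

variable {hg} in
theorem IsClosed.gen_subset {A C : Set H} (h : hg.IsClosed C) (hA : A ⊆ C) : hg.gen A ⊆ C :=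
  Set.sInter_subset_of_mem ⟨h, hA⟩

variable {hg} in
theorem IsClosed.gen_eq {C : Set H} (h : hg.IsClosed C) : hg.gen C = C :=
  (h.gen_subset subset_rfl).antisymm (hg.subset_gen C)

theorem isClosed_univ : hg.IsClosed Set.univ := ⟨⟨hg.e, trivial⟩, Set.subset_univ _⟩

theorem isClosed_e : hg.IsClosed {hg.e} := by
  refine ⟨⟨hg.e, rfl⟩, ?_⟩
  rw [Set.image_singleton, star_e, smul_e]

variable {hg} in
theorem IsInvolution.star_eq {q : H} (h : hg.IsInvolution q) : hg.star q = q := by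
  rcases h.2.star_mem (p := q) (by simp) with h' | h'
  · exact absurd (by rw [← hg.star_star q, h', star_e]) h.1
  · exact h'

variable {hg} in
theorem IsInvolution.hmul_subset {q : H} (h : hg.IsInvolution q) :
    hg.hmul q q ⊆ {hg.e, q} := by
  have := h.2.star_hmul_subset (p := q) (q := q) (by simp) (by simp)
  rwa [h.star_eq] at this

theorem e_mem_listProd {l : List (Set H)} (hl : ∀ A ∈ l, hg.e ∈ A) : hg.e ∈ hg.listProd l := by
  induction l with
  | nil => simp [listProd]
  | cons A l ih =>
    exact hg.subset_smul_left (ih fun B hB => hl B (by simp [hB])) (hl A (by simp))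

theorem subset_listProd {l : List (Set H)} (hl : ∀ A ∈ l, hg.e ∈ A) {B : Set H} (hB : B ∈ l) :
    B ⊆ hg.listProd l := by
  induction l with
  | nil => simp at hB
  | cons A l ih =>
    have hl' : ∀ A ∈ l, hg.e ∈ A := fun B hB => hl B (by simp [hB])
    rcases List.mem_cons.1 hB with rfl | hB
    · exact hg.subset_smul_left (hg.e_mem_listProd hl')
    · exact (ih hl' hB).trans (hg.subset_smul_right (hl A (by simp)))

theorem listProd_eq_e {l : List (Set H)} (hl : ∀ A ∈ l, A = {hg.e}) : hg.listProd l = {hg.e} := by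
  induction l with
  | nil => rfl
  | cons A l ih =>
    rw [listProd, hl A (by simp), ih fun B hB => hl B (by simp [hB]), e_smul]

theorem listProd_mono {ι : Type*} (l : List ι) {f g : ι → Set H} (h : ∀ i, f i ⊆ g i) :
    hg.listProd (l.map f) ⊆ hg.listProd (l.map g) := by
  induction l with
  | nil => rfl
  | cons i l ih => exact hg.smul_mono (h i) ih

theorem smul_listProd_comm {A : Set H} {l : List (Set H)}
    (h : ∀ B ∈ l, hg.smul A B = hg.smul B A) :
    hg.smul A (hg.listProd l) = hg.smul (hg.listProd l) A := by
  induction l with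
  | nil => simp [listProd, smul_e, e_smul]
  | cons B l ih =>
    rw [listProd, ← smul_assoc, h B (by simp), smul_assoc, ih fun C hC => h C (by simp [hC]),
      smul_assoc]

theorem exists_mem_listProd {ι : Type*} {l : List ι} (hl : l.Nodup) (f : ι → Set H)
    (hf : ∀ i, (f i).Nonempty) {x : H} (hx : x ∈ hg.listProd (l.map f)) :
    ∃ ρ : ι → H, (∀ i, ρ i ∈ f i) ∧ x ∈ hg.listProd (l.map fun i => {ρ i}) := by
  classical
  induction l generalizing x with
  | nil => exact ⟨fun i => (hf i).some, fun i => (hf i).some_mem, hx⟩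
  | cons i l ih =>
    obtain ⟨a, ha, b, hb, hx⟩ := hx
    obtain ⟨hi, hl⟩ := List.nodup_cons.1 hl
    obtain ⟨ρ, hρ, hb⟩ := ih hl hb
    refine ⟨Function.update ρ i a, fun j => ?_, a, by simp, b, ?_, hx⟩
    · rcases eq_or_ne j i with rfl | hj
      · simpa using ha
      · simpa [hj] using hρ j
    · convert hb using 2
      refine List.map_congr_left fun j hj => ?_
      rw [Function.update_of_ne (by rintro rfl; exact hi hj)]

/-- Commutativity of the hypermultiplication. -/
def IsComm : Prop := ∀ p q : H, hg.hmul p q = hg.hmul q p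

section Comm

variable {hg}

theorem IsComm.smul_comm (hc : hg.IsComm) (A B : Set H) : hg.smul A B = hg.smul B A := by
  ext x
  constructor <;>
  · rintro ⟨a, ha, b, hb, hx⟩
    exact ⟨b, hb, a, ha, hc a b ▸ hx⟩

theorem IsComm.smul_smul_smul_comm (hc : hg.IsComm) (A B C D : Set H) :
    hg.smul (hg.smul A B) (hg.smul C D) = hg.smul (hg.smul A C) (hg.smul B D) := by
  rw [smul_assoc, ← hg.smul_assoc B, hc.smul_comm B C, smul_assoc, smul_assoc]

theorem IsComm.listProd_smul (hc : hg.IsComm) {ι : Type*} (l : List ι) (f g : ι → Set H) :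
    hg.smul (hg.listProd (l.map f)) (hg.listProd (l.map g)) =
      hg.listProd (l.map fun i => hg.smul (f i) (g i)) := by
  induction l with
  | nil => exact hg.smul_e _
  | cons i l ih =>
    simp only [List.map_cons, listProd]
    rw [hc.smul_smul_smul_comm, ih]

theorem IsComm.star_mem_hmul (hc : hg.IsComm) {a p q : H} (h : a ∈ hg.hmul p q) :
    hg.star a ∈ hg.hmul (hg.star p) (hg.star q) := by
  rwa [hg.h3l, hg.star_star, hc, ← hg.h3l, ← hg.h3r]

theorem IsComm.isClosed_smul (hc : hg.IsComm) {A B : Set H} (hA : hg.IsClosed A)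
    (hB : hg.IsClosed B) : hg.IsClosed (hg.smul A B) := by
  refine ⟨⟨hg.e, hg.subset_smul_left hB.e_mem hA.e_mem⟩, ?_⟩
  have h : hg.star '' hg.smul A B ⊆ hg.smul A B := by
    rintro _ ⟨x, ⟨a, ha, b, hb, hx⟩, rfl⟩
    exact ⟨_, hA.star_mem ha, _, hB.star_mem hb, hc.star_mem_hmul hx⟩
  refine (hg.smul_mono h subset_rfl).trans ?_
  rw [hc.smul_smul_smul_comm]
  exact hg.smul_mono (hA.smul_subset subset_rfl subset_rfl) (hB.smul_subset subset_rfl subset_rfl)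

theorem IsComm.isClosed_listProd (hc : hg.IsComm) {l : List (Set H)}
    (h : ∀ A ∈ l, hg.IsClosed A) : hg.IsClosed (hg.listProd l) := by
  induction l with
  | nil => exact hg.isClosed_e
  | cons A l ih => exact hc.isClosed_smul (h A (by simp)) (ih fun B hB => h B (by simp [hB]))

theorem IsComm.isStronglyNormal_iff (hc : hg.IsComm) {F G : Set H} (hF : hg.IsClosed F)
    (hG : hg.IsClosed G) (h : F ⊆ G) :
    hg.IsStronglyNormal F G ↔ ∀ p ∈ G, hg.hmul (hg.star p) p ⊆ F := by
  have key : ∀ p, hg.smul (hg.smul {hg.star p} F) {p} = hg.smul F (hg.hmul (hg.star p) p) := by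
    intro p
    rw [hc.smul_comm {hg.star p}, smul_assoc, smul_singleton]
  simp only [IsStronglyNormal, key]
  constructor
  · rintro ⟨-, -, -, h⟩ p hp
    exact (hg.subset_smul_right hF.e_mem).trans (h p hp)
  · exact fun h' => ⟨hF, hG, h, fun p hp => hF.smul_subset subset_rfl (h' p hp)⟩

theorem IsComm.isClosed_Othin (hc : hg.IsComm) {G : Set H} (hG : hg.IsClosed G) :
    hg.IsClosed (hg.Othin G) := by
  refine ⟨⟨hg.e, hG.e_mem, by rw [IsThin, star_e, hg.idl]⟩, ?_⟩
  rintro x ⟨_, ⟨p, hp, rfl⟩, q, hq, hx⟩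
  refine ⟨hG.star_hmul_subset hp.1 hq.1 hx, ?_⟩
  refine Set.Subset.antisymm ?_ (by simpa using hg.e_mem_star_mul x)
  have hx' := hc.star_mem_hmul hx
  rw [hg.star_star] at hx'
  have h : hg.hmul (hg.star x) x ⊆
      hg.smul (hg.smul {p} {hg.star q}) (hg.smul {hg.star p} {q}) := by
    rw [smul_singleton, smul_singleton]
    exact fun y hy => ⟨_, hx', _, hx, hy⟩
  refine h.trans ?_
  rw [hc.smul_smul_smul_comm, smul_singleton, smul_singleton, hc p, hp.2, hq.2, smul_e]

end Comm

end Hypergroup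

namespace EA2Data

open Hypergroup

variable {H : Type*} (E : EA2Data H)

theorem mem_fam {i : Fin E.n} {x : H} (h : x ∈ E.fam i) : x = E.hg.e ∨ x = E.q i :=
  (E.invol i).2.gen_subset (by simp) h

theorem q_mem_fam (i : Fin E.n) : E.q i ∈ E.fam i := E.hg.subset_gen _ rfl

theorem q_notMem_fam {i j : Fin E.n} (h : i ≠ j) : E.q j ∉ E.fam i := by
  intro hj
  have h' : E.q j ∈ E.fam i ∩ E.hg.cofactor E.fam i := by
    refine ⟨hj, E.hg.subset_listProd ?_ ?_ (E.q_mem_fam j)⟩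
    · simp only [List.mem_map]
      rintro _ ⟨k, -, rfl⟩
      exact (E.hg.isClosed_gen _).e_mem
    · exact List.mem_map_of_mem (by simpa using h.symm)
  rw [show E.fam i ∩ E.hg.cofactor E.fam i = {E.hg.e} from E.dp.2.2 i] at h'
  exact (E.invol j).1 h'

theorem hmul_q_subset {i j : Fin E.n} (h : i ≠ j) :
    E.hg.hmul (E.q i) (E.q j) ⊆ E.hg.hmul (E.q j) (E.q i) := by
  intro a ha
  have h' : a ∈ E.hg.smul {E.q i} (E.fam j) := ⟨_, rfl, _, E.q_mem_fam j, ha⟩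
  rw [← show E.hg.smul (E.fam j) {E.q i} = E.hg.smul {E.q i} (E.fam j) from
    (E.dp.1 j).2.2.2 (E.q i) trivial] at h'
  obtain ⟨b, hb, _, rfl, hab⟩ := h'
  rcases E.mem_fam hb with rfl | rfl
  · rw [E.hg.idl] at hab
    rw [hab, E.hg.h3r] at ha
    exact absurd ((E.hg.isClosed_gen _).star_hmul_subset (E.q_mem_fam i) (E.q_mem_fam i) ha)
      (E.q_notMem_fam h)
  · exact hab

theorem exists_isDecomp (x : H) :
    ∃ ρ, (∀ i, ρ i = E.hg.e ∨ ρ i = E.q i) ∧ x ∈ E.hg.famProd ρ := by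
  have h : x ∈ E.hg.dcover E.fam x := by
    rw [show E.hg.dcover E.fam x = {x} from E.constrained x]
    rfl
  obtain ⟨ρ, h, hx⟩ := h
  exact ⟨ρ, fun i => E.mem_fam (h.1 i), hx⟩

theorem famProd_eq {ρ : Fin E.n → H} (hρ : ∀ i, ρ i = E.hg.e ∨ ρ i = E.q i) {x : H}
    (hx : x ∈ E.hg.famProd ρ) : E.hg.famProd ρ = {x} := by
  refine Set.Subset.antisymm ?_ (by simpa using hx)
  rw [← show E.hg.dcover E.fam x = {x} from E.constrained x]
  refine fun y hy => ⟨ρ, ⟨fun i => ?_, hx⟩, hy⟩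
  rcases hρ i with h | h <;> rw [h]
  exacts [(E.hg.isClosed_gen _).e_mem, E.q_mem_fam i]

theorem isComm : E.hg.IsComm := by
  have hq : ∀ i j, E.hg.hmul (E.q i) (E.q j) = E.hg.hmul (E.q j) (E.q i) := fun i j => by
    rcases eq_or_ne i j with rfl | h
    · rfl
    · exact (E.hmul_q_subset h).antisymm (E.hmul_q_subset h.symm)
  intro x y
  obtain ⟨ρ, hρ, hx⟩ := E.exists_isDecomp x
  obtain ⟨σ, hσ, hy⟩ := E.exists_isDecomp y
  rw [← smul_singleton, ← smul_singleton, ← E.famProd_eq hρ hx, ← E.famProd_eq hσ hy]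
  refine E.hg.smul_listProd_comm fun B hB => ?_
  obtain ⟨j, -, rfl⟩ := List.mem_map.1 hB
  refine (E.hg.smul_listProd_comm fun A hA => ?_).symm
  obtain ⟨i, -, rfl⟩ := List.mem_map.1 hA
  rw [smul_singleton, smul_singleton]
  rcases hσ j with h | h <;> rcases hρ i with h' | h' <;>
    simp [h, h', E.hg.idl, E.hg.idr, hq i j]

section Decomp

variable {E} {ρ : Fin E.n → H}

theorem e_mem_hmul_self (hρ : ∀ i, ρ i = E.hg.e ∨ ρ i = E.q i)
    (i : Fin E.n) : E.hg.e ∈ E.hg.hmul (ρ i) (ρ i) := by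
  have := E.hg.e_mem_star_mul (ρ i)
  rcases hρ i with h | h
  · simp [h, E.hg.idl]
  · rwa [h, (E.invol i).star_eq, ← h] at this

theorem star_hmul_self (hρ : ∀ i, ρ i = E.hg.e ∨ ρ i = E.q i)
    {x : H} (hx : x ∈ E.hg.famProd ρ) :
    E.hg.hmul (E.hg.star x) x =
      E.hg.listProd ((List.finRange E.n).map fun i => E.hg.hmul (ρ i) (ρ i)) := by
  have h : E.hg.hmul x x =
      E.hg.listProd ((List.finRange E.n).map fun i => E.hg.hmul (ρ i) (ρ i)) := by
    rw [← smul_singleton, ← E.famProd_eq hρ hx, famProd, E.isComm.listProd_smul]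
    simp only [smul_singleton]
  rw [E.hg.star_eq_of_e_mem (p := x), h]
  rw [h]
  refine E.hg.e_mem_listProd fun A hA => ?_
  obtain ⟨i, -, rfl⟩ := List.mem_map.1 hA
  exact e_mem_hmul_self hρ i

theorem mem_hmul_self (hρ : ∀ i, ρ i = E.hg.e ∨ ρ i = E.q i)
    {i : Fin E.n} (h : E.hg.IsThick (ρ i)) : ρ i ∈ E.hg.hmul (ρ i) (ρ i) := by
  rcases hρ i with h' | h'
  · simp [h', E.hg.idl]
  · by_contra hc
    refine h (Set.Subset.antisymm ?_ (by simpa using E.hg.e_mem_star_mul _))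
    rw [h'] at hc ⊢
    rw [(E.invol i).star_eq]
    intro x hx
    rcases (E.invol i).hmul_subset hx with rfl | rfl
    exacts [rfl, absurd hx hc]

theorem mem_star_hmul_self (hρ : ∀ i, ρ i = E.hg.e ∨ ρ i = E.q i)
    {x : H} (hx : x ∈ E.hg.famProd ρ) {i : Fin E.n}
    (h : E.hg.IsThick (ρ i)) : ρ i ∈ E.hg.hmul (E.hg.star x) x := by
  rw [star_hmul_self hρ hx]
  refine E.hg.subset_listProd (fun A hA => ?_)
    (List.mem_map_of_mem (List.mem_finRange i)) (mem_hmul_self hρ h)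
  obtain ⟨i, -, rfl⟩ := List.mem_map.1 hA
  exact e_mem_hmul_self hρ i

end Decomp

theorem star_hmul_self_subset {C : Set H} (hC : E.hg.IsClosed C)
    (h : ∀ i, E.hg.IsThick (E.q i) → E.q i ∈ C) (x : H) : E.hg.hmul (E.hg.star x) x ⊆ C := by
  obtain ⟨ρ, hρ, hx⟩ := E.exists_isDecomp x
  rw [star_hmul_self hρ hx]
  refine hC.listProd_subset fun A hA => ?_
  obtain ⟨i, -, rfl⟩ := List.mem_map.1 hA
  rcases hρ i with h' | h' <;> rw [h']
  · simpa [E.hg.idl] using hC.e_mem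
  · by_cases ht : E.hg.IsThick (E.q i)
    · refine (E.invol i).hmul_subset.trans ?_
      rintro x (rfl | rfl)
      exacts [hC.e_mem, h i ht]
    · have := not_not.1 ht
      rw [IsThin, (E.invol i).star_eq] at this
      simpa [this] using hC.e_mem

/-- `r` is the product of the thick elements among the generating involutions. -/
def IsThickProduct (r : H) : Prop :=
  E.support r = {x : H | ∃ i : Fin E.n, x = E.q i ∧ E.hg.IsThick (E.q i)}

variable {E}

theorem IsThickProduct.q_mem {r : H} (hr : E.IsThickProduct r) {i : Fin E.n}
    (h : E.hg.IsThick (E.q i)) : E.q i ∈ E.hg.hmul (E.hg.star r) r := by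
  have hi : E.q i ∈ E.support r := hr.symm ▸ ⟨i, rfl, h⟩
  obtain ⟨-, ρ, hρ, j, hj⟩ := hi
  rw [← hj] at h ⊢
  exact mem_star_hmul_self (fun k => E.mem_fam (hρ.1 k)) hρ.2 h

theorem IsThickProduct.exists_isDecomp {r : H} (hr : E.IsThickProduct r) :
    ∃ ρ : Fin E.n → H, (∀ i, ρ i = E.hg.e ∨ ρ i = E.q i ∧ E.hg.IsThick (E.q i)) ∧
      r ∈ E.hg.famProd ρ := by
  obtain ⟨ρ, hρ, h⟩ := EA2Data.exists_isDecomp E r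
  refine ⟨ρ, fun i => ?_, h⟩
  refine (hρ i).imp_right fun hi => ⟨hi, ?_⟩
  have hs : E.q i ∈ E.support r := by
    refine ⟨(E.invol i).1, ρ, ⟨fun j => ?_, h⟩, i, hi⟩
    rcases hρ j with h | h <;> rw [h]
    exacts [(E.hg.isClosed_gen _).e_mem, E.q_mem_fam j]
  rw [hr] at hs
  obtain ⟨j, hj, ht⟩ := hs
  rwa [hj]

theorem IsThickProduct.q_mem_gen {r : H} (hr : E.IsThickProduct r) {i : Fin E.n}
    (h : E.hg.IsThick (E.q i)) : E.q i ∈ E.hg.gen {r} :=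
  (E.hg.isClosed_gen {r}).star_hmul_subset (E.hg.subset_gen _ rfl) (E.hg.subset_gen _ rfl)
    (hr.q_mem h)

theorem IsThickProduct.gen_subset {r : H} (hr : E.IsThickProduct r) {C : Set H}
    (hC : E.hg.IsClosed C) (h : E.hg.hmul (E.hg.star r) r ⊆ C) : E.hg.gen {r} ⊆ C := by
  refine hC.gen_subset (Set.singleton_subset_iff.2 ?_)
  obtain ⟨ρ, hρ, hx⟩ := hr.exists_isDecomp
  refine hC.listProd_subset (fun A hA => ?_) hx
  obtain ⟨i, -, rfl⟩ := List.mem_map.1 hA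
  rw [Set.singleton_subset_iff]
  rcases hρ i with h' | ⟨h', ht⟩ <;> rw [h']
  exacts [hC.e_mem, h (hr.q_mem ht)]

theorem IsThickProduct.isStronglyNormal_gen {r : H} (hr : E.IsThickProduct r) {G : Set H}
    (hG : E.hg.IsClosed G) (h : E.hg.gen {r} ⊆ G) : E.hg.IsStronglyNormal (E.hg.gen {r}) G :=
  (E.isComm.isStronglyNormal_iff (E.hg.isClosed_gen _) hG h).2 fun x _ =>
    E.star_hmul_self_subset (E.hg.isClosed_gen _) (fun _ => hr.q_mem_gen) x

theorem IsThickProduct.Osup_eq {r : H} (hr : E.IsThickProduct r) {G : Set H}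
    (hG : E.hg.IsClosed G) (h : E.hg.gen {r} ⊆ G) : E.hg.Osup G = E.hg.gen {r} := by
  rw [Osup, hG.gen_eq]
  refine (Set.sInter_subset_of_mem (hr.isStronglyNormal_gen hG h)).antisymm
    (Set.subset_sInter fun F hF => ?_)
  exact hr.gen_subset hF.1 ((E.isComm.isStronglyNormal_iff hF.1 hG hF.2.2.1).1 hF r
    (h (E.hg.subset_gen _ rfl)))

theorem IsThickProduct.isStronglyNormal_iff {r : H} (hr : E.IsThickProduct r) {G : Set H} :
    E.hg.IsStronglyNormal G Set.univ ↔ E.hg.IsClosed G ∧ E.hg.gen {r} ⊆ G := by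
  constructor
  · refine fun h => ⟨h.1, hr.gen_subset h.1 ?_⟩
    exact (E.isComm.isStronglyNormal_iff h.1 h.2.1 h.2.2.1).1 h r trivial
  · refine fun h => (E.isComm.isStronglyNormal_iff h.1 E.hg.isClosed_univ
      (Set.subset_univ _)).2 fun x _ => ?_
    exact E.star_hmul_self_subset h.1 (fun _ hi => h.2 (hr.q_mem_gen hi)) x

theorem IsThickProduct.eq_e_of_isThin {r : H} (hr : E.IsThickProduct r) {t : H}
    (ht : t ∈ E.hg.gen {r}) (h : E.hg.IsThin t) : t = E.hg.e := by
  let W : Fin E.n → Set H := fun i => {x | x = E.hg.e ∨ x = E.q i ∧ E.hg.IsThick (E.q i)}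
  have hW : ∀ i, E.hg.IsClosed (W i) := fun i => by
    by_cases hi : E.hg.IsThick (E.q i)
    · convert (E.invol i).2 using 1
      ext; simp [W, hi]
    · convert E.hg.isClosed_e using 1
      ext; simp [W, hi]
  have hclosed : E.hg.IsClosed (E.hg.listProd ((List.finRange E.n).map W)) := by
    refine E.isComm.isClosed_listProd fun A hA => ?_
    obtain ⟨i, -, rfl⟩ := List.mem_map.1 hA
    exact hW i
  obtain ⟨ρ, hρ, hx⟩ := hr.exists_isDecomp
  have ht' := hclosed.gen_subset (Set.singleton_subset_iff.2
    (E.hg.listProd_mono _ (fun i => Set.singleton_subset_iff.2 (hρ i)) hx)) ht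
  obtain ⟨σ, hσ, ht'⟩ := E.hg.exists_mem_listProd (List.nodup_finRange _) W
    (fun i => (hW i).1) ht'
  rw [E.hg.listProd_eq_e] at ht'
  · exact ht'
  intro A hA
  obtain ⟨i, -, rfl⟩ := List.mem_map.1 hA
  rcases hσ i with hi | ⟨hi, hthick⟩
  · rw [hi]
  · have := mem_star_hmul_self (fun j => (hσ j).imp_right And.left) ht' (hi ▸ hthick)
    rw [h] at this
    rw [this]

theorem IsThickProduct.exists_mem_hmul {r : H} (hr : E.IsThickProduct r) (x : H) :
    ∃ t ∈ E.hg.gen {r}, ∃ f, E.hg.IsThin f ∧ x ∈ E.hg.hmul t f := by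
  classical
  obtain ⟨ρ, hρ, hx⟩ := EA2Data.exists_isDecomp E x
  let a : Fin E.n → H := fun i => if E.hg.IsThick (ρ i) then ρ i else E.hg.e
  let b : Fin E.n → H := fun i => if E.hg.IsThick (ρ i) then E.hg.e else ρ i
  have hb : ∀ i, b i = E.hg.e ∨ b i = E.q i := fun i => by
    by_cases h : E.hg.IsThick (ρ i)
    · simp [b, h]
    · simpa [b, h] using hρ i
  have hab : E.hg.smul (E.hg.famProd a) (E.hg.famProd b) = E.hg.famProd ρ := by
    rw [famProd, famProd, E.isComm.listProd_smul, famProd]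
    congr 2
    funext i
    by_cases h : E.hg.IsThick (ρ i) <;> simp [a, b, h, smul_e, e_smul]
  rw [← hab] at hx
  obtain ⟨t, ht, f, hf, hx⟩ := hx
  refine ⟨t, (E.hg.isClosed_gen _).listProd_subset (fun A hA => ?_) ht, f, ?_, hx⟩
  · obtain ⟨i, -, rfl⟩ := List.mem_map.1 hA
    rw [Set.singleton_subset_iff]
    by_cases h : E.hg.IsThick (ρ i)
    · rcases hρ i with h' | h'
      · simpa [a, h'] using (E.hg.isClosed_gen _).e_mem
      · have ha : a i = E.q i := (if_pos h).trans h'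
        exact ha ▸ hr.q_mem_gen (h' ▸ h)
    · simpa [a, h] using (E.hg.isClosed_gen _).e_mem
  · rw [IsThin, star_hmul_self hb hf]
    refine E.hg.listProd_eq_e fun A hA => ?_
    obtain ⟨i, -, rfl⟩ := List.mem_map.1 hA
    by_cases h : E.hg.IsThick (ρ i)
    · simp [b, h, E.hg.idl]
    · have h' : E.hg.IsThin (ρ i) := not_not.1 h
      have hs : E.hg.star (ρ i) = ρ i := by
        rcases hρ i with h | h <;> rw [h]
        exacts [E.hg.star_e, (E.invol i).star_eq]
      rw [IsThin, hs] at h'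
      simpa [b, h] using h'

theorem IsThickProduct.eq_smul_Othin {r : H} (hr : E.IsThickProduct r) {G : Set H}
    (hG : E.hg.IsClosed G) (h : E.hg.gen {r} ⊆ G) :
    G = E.hg.smul (E.hg.gen {r}) (E.hg.Othin G) := by
  refine Set.Subset.antisymm (fun x hx => ?_) (hG.smul_subset h fun _ hx => hx.1)
  obtain ⟨t, ht, f, hf, hxf⟩ := hr.exists_mem_hmul x
  exact ⟨t, ht, f, ⟨hG.star_hmul_subset (h ht) hx ((E.hg.h3r _ _ _).1 hxf), hf⟩, hxf⟩

end EA2Data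

end HyperPaper

/-- Let r be the (unique) element of H whose support consists precisely of
all thick elements of H among q_1,…,q_p. Then G ⊆ H is a strongly normal closed subset
of H iff O^ϑ(G) = O^ϑ(H) = ⟨r⟩ and there exists F ⊆ H such that F^γ is a subgroup of the
elementary abelian 2-group O_ϑ(H)^γ, G = ⟨r⟩·F, ⟨r⟩ ∩ F = {e}, and O_ϑ(G) = F. -/
theorem stmt9 {H : Type*} (E : EA2Data H) (G : Set H) (r : H)
    (hr : E.support r = {x : H | ∃ i : Fin E.n, x = E.q i ∧ E.hg.IsThick (E.q i)}) :
    E.hg.IsStronglyNormal G Set.univ ↔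
      (E.hg.Osup G = E.hg.Osup Set.univ ∧ E.hg.Osup Set.univ = E.hg.gen {r} ∧
        ∃ F : Set H,
          (E.hg.IsClosed F ∧ F ⊆ E.hg.Othin Set.univ) ∧
          G = E.hg.smul (E.hg.gen {r}) F ∧
          E.hg.gen {r} ∩ F = {E.hg.e} ∧
          E.hg.Othin G = F) := by
  replace hr : E.IsThickProduct r := hr
  rw [hr.isStronglyNormal_iff]
  constructor
  · rintro ⟨hG, h⟩
    have huniv := hr.Osup_eq E.hg.isClosed_univ (Set.subset_univ _)
    have hO := E.isComm.isClosed_Othin hG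
    refine ⟨(hr.Osup_eq hG h).trans huniv.symm, huniv, E.hg.Othin G,
      ⟨hO, fun x hx => ⟨trivial, hx.2⟩⟩, hr.eq_smul_Othin hG h, ?_, rfl⟩
    refine Set.Subset.antisymm (fun x hx => hr.eq_e_of_isThin hx.1 hx.2.2) ?_
    exact Set.singleton_subset_iff.2 ⟨(E.hg.isClosed_gen _).e_mem, hO.e_mem⟩
  · rintro ⟨-, -, F, ⟨hF, -⟩, rfl, -, -⟩
    exact ⟨E.isComm.isClosed_smul (E.hg.isClosed_gen _) hF, E.hg.subset_smul_left hF.e_mem⟩
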